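/- Let m ≥ 3 and let B₁,…,B_m ∈ 𝓛(ℋ) be selfadjoint operators satisfying Hypotheses (HM). Then {B₁,…,B_m} is strongly indefinite. Consequently, for any selfadjoint A ∈ 𝓛(ℋ), ⟨Ax, x⟩ ≥ 0 for every x ∈ ⋂_{i=1}^m Qᵢ if and only if there exist λ₁,…,λ_m ∈ ℝ with A + ∑_{i=1}^m λᵢBᵢ ≥ 0. -/

import Mathlib

open scoped InnerProductSpace

variable {H : Type*} [NormedAddCommGroup H] [InnerProductSpace ℂ H] [CompleteSpace H]

/-- The real quadratic form `x ↦ Re⟨B x, x⟩` associated to a bounded operator `B`. -/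
noncomputable def qf (B : H →L[ℂ] H) (x : H) : ℝ := (⟪B x, x⟫_ℂ).re

/-- An operator `A` is positive semidefinite if `⟨A x, x⟩ ≥ 0` for all `x`. -/
def PosSemidef (A : H →L[ℂ] H) : Prop := ∀ x : H, 0 ≤ qf A x

/-- A selfadjoint operator is indefinite if its quadratic form takes both strictly
positive and strictly negative values. -/
def Indefinite (B : H →L[ℂ] H) : Prop := (∃ x : H, 0 < qf B x) ∧ (∃ x : H, qf B x < 0)

/-- `Q(B)` : the set of neutral vectors of the quadratic form of `B`. -/
def Qset (B : H →L[ℂ] H) : Set H := {x : H | qf B x = 0}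

/-- `B` is indefinite on a set `S` if its quadratic form takes both strictly positive
and strictly negative values on `S`. -/
def IndefiniteOn (B : H →L[ℂ] H) (S : Set H) : Prop :=
  (∃ x ∈ S, 0 < qf B x) ∧ (∃ x ∈ S, qf B x < 0)

/-- A family `{B₁,…,B_m}` is weakly indefinite if every nontrivial real linear
combination `∑ μᵢ Bᵢ` is indefinite. -/
def WeaklyIndefinite {m : ℕ} (B : Fin m → (H →L[ℂ] H)) : Prop :=
  ∀ μ : Fin m → ℝ, μ ≠ 0 → Indefinite (∑ i, μ i • B i)

/-- A family `{B₁,…,B_m}` is indefinite if each `B_j` is indefinite on `⋂_{i≠j} Qᵢ`. -/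
def IndefiniteFamily {m : ℕ} (B : Fin m → (H →L[ℂ] H)) : Prop :=
  ∀ j : Fin m, IndefiniteOn (B j) {x : H | ∀ i, i ≠ j → qf (B i) x = 0}

/-- A family `{B₁,…,B_m}` is strongly indefinite if it is weakly indefinite and for all
indices `i, j, k`, whenever `x₋ ∈ 𝒫ᵢ⁻ ∩ Q_j ∩ Q_k` and `x₊ ∈ 𝒫ᵢ⁺ ∩ Q_j ∩ Q_k` there is
`θ ∈ [0, π)` with `Re⟨B_j x₊, e^{iθ} x₋⟩ = Re⟨B_k x₊, e^{iθ} x₋⟩ = 0`. -/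
def StronglyIndefinite {m : ℕ} (B : Fin m → (H →L[ℂ] H)) : Prop :=
  WeaklyIndefinite B ∧
  ∀ i j k : Fin m, ∀ xm xp : H,
    qf (B i) xm < 0 → qf (B j) xm = 0 → qf (B k) xm = 0 →
    0 < qf (B i) xp → qf (B j) xp = 0 → qf (B k) xp = 0 →
    ∃ θ : ℝ, θ ∈ Set.Ico 0 Real.pi ∧
      (⟪(B j) xp, Complex.exp (θ * Complex.I) • xm⟫_ℂ).re = 0 ∧
      (⟪(B k) xp, Complex.exp (θ * Complex.I) • xm⟫_ℂ).re = 0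

omit [CompleteSpace H] in
lemma qf_add (A B : H →L[ℂ] H) (x : H) : qf (A + B) x = qf A x + qf B x := by
  simp [qf]

omit [CompleteSpace H] in
lemma qf_smul (t : ℝ) (B : H →L[ℂ] H) (x : H) : qf (t • B) x = t * qf B x := by
  simp [qf, inner_smul_left_eq_star_smul]

omit [CompleteSpace H] in
lemma qf_neg (B : H →L[ℂ] H) (x : H) : qf (-B) x = -qf B x := by
  simp [qf]

omit [CompleteSpace H] in
lemma qf_sum {ι : Type*} (s : Finset ι) (B : ι → (H →L[ℂ] H)) (x : H) :
    qf (∑ i ∈ s, B i) x = ∑ i ∈ s, qf (B i) x := by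
  simp [qf]

omit [CompleteSpace H] in
lemma qf_sum_smul {ι : Type*} (s : Finset ι) (l : ι → ℝ) (B : ι → (H →L[ℂ] H)) (x : H) :
    qf (∑ i ∈ s, l i • B i) x = ∑ i ∈ s, l i * qf (B i) x := by
  simp only [qf_sum, qf_smul]

lemma qf_real_combination {B : H →L[ℂ] H} (hB : IsSelfAdjoint B) (x y : H) (a b : ℝ) :
    qf B (a • x + b • y)
      = a ^ 2 * qf B x + 2 * a * b * (⟪B x, y⟫_ℂ).re + b ^ 2 * qf B y := by
  have h : (⟪B y, x⟫_ℂ).re = (⟪B x, y⟫_ℂ).re := by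
    rw [hB.isSymmetric.apply_clm y x, ← inner_conj_symm, Complex.conj_re]
  simp only [qf, RCLike.real_smul_eq_coe_smul (K := ℂ), map_add, map_smul, inner_add_left,
    inner_add_right, inner_smul_left, inner_smul_right]
  simp [h]
  ring

omit [CompleteSpace H] in
lemma qf_smul_of_norm_eq_one (B : H →L[ℂ] H) (x : H) {u : ℂ} (hu : ‖u‖ = 1) :
    qf B (u • x) = qf B x := by
  have h : (starRingEnd ℂ) u * u = 1 := by
    rw [mul_comm, Complex.mul_conj, Complex.normSq_eq_norm_sq, hu]; simp
  simp only [qf, map_smul, inner_smul_left, inner_smul_right]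
  rw [← mul_assoc, mul_comm u, h, one_mul]

omit [CompleteSpace H] in
lemma exists_rotation_re_inner_eq_zero (v w : H) :
    ∃ θ ∈ Set.Ico 0 Real.pi, (⟪v, Complex.exp (θ * Complex.I) • w⟫_ℂ).re = 0 := by
  set c := ⟪v, w⟫_ℂ with hc
  set φ := Real.pi / 2 - c.arg with hφ
  refine ⟨toIcoMod Real.pi_pos 0 φ, by simpa using toIcoMod_mem_Ico Real.pi_pos 0 φ, ?_⟩
  rw [inner_smul_right, ← hc, ← Complex.norm_mul_exp_arg_mul_I c]
  rw [mul_left_comm, ← Complex.exp_add, ← add_mul, ← Complex.ofReal_add, Complex.re_ofReal_mul,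
    Complex.exp_ofReal_mul_I_re]
  have h : Real.cos (toIcoMod Real.pi_pos 0 φ + c.arg) = 0 := by
    rw [Real.cos_eq_zero_iff]
    refine ⟨-toIcoDiv Real.pi_pos 0 φ, ?_⟩
    rw [toIcoMod, hφ, zsmul_eq_mul]
    push_cast
    ring
  rw [h, mul_zero]

/-- If `x` and `y` have opposite signs for `C` and are neutral for both `D` and `E`, and some
combination of `C`, `D`, `E` is semidefinite and nonzero on every real plane without common
neutral vectors, then the cross terms of `D` and `E` vanish. -/
lemma re_inner_eq_zero_of_opposite_signs {C D E : H →L[ℂ] H} (hC : IsSelfAdjoint C)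
    (hD : IsSelfAdjoint D) (hE : IsSelfAdjoint E)
    (hS : ∀ S : Submodule ℝ H, Module.finrank ℝ S = 2 →
      (∀ x ∈ S, qf C x = 0 → qf D x = 0 → qf E x = 0 → x = 0) →
      ∃ c d e : ℝ, (∀ x ∈ S, 0 ≤ qf (c • C + d • D + e • E) x) ∧
        ¬(∀ x ∈ S, qf (c • C + d • D + e • E) x = 0))
    {x y : H} (hCx : 0 < qf C x) (hCy : qf C y < 0) (hDx : qf D x = 0) (hDy : qf D y = 0)
    (hEx : qf E x = 0) (hEy : qf E y = 0) :
    (⟪D x, y⟫_ℂ).re = 0 ∧ (⟪E x, y⟫_ℂ).re = 0 := by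
  by_contra hne
  have hsq : ∀ {T : H →L[ℂ] H} (_ : IsSelfAdjoint T) (z : H) (a : ℝ),
      qf T (a • z) = a ^ 2 * qf T z := fun hT z a ↦ by
    simpa using qf_real_combination hT z z a 0
  have hli : LinearIndependent ℝ ![x, y] := by
    rw [LinearIndependent.pair_iff]
    intro a b hab
    have h : a • x = (-b) • y := by rw [neg_smul]; exact eq_neg_of_add_eq_zero_left hab
    have h' := congrArg (qf C) h
    rw [hsq hC, hsq hC] at h'
    have h1 : 0 ≤ a ^ 2 * qf C x := by positivity
    have h2 : (-b) ^ 2 * qf C y ≤ 0 := mul_nonpos_of_nonneg_of_nonpos (sq_nonneg _) hCy.le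
    have h3 : a ^ 2 * qf C x = 0 := by linarith
    have h4 : (-b) ^ 2 * qf C y = 0 := by linarith
    simpa [hCx.ne', hCy.ne] using And.intro h3 h4
  have hfin : Module.finrank ℝ (Submodule.span ℝ ({x, y} : Set H)) = 2 := by
    have h := finrank_span_eq_card hli
    rwa [Matrix.range_cons_cons_empty, Fintype.card_fin] at h
  obtain ⟨c, d, e, hnn, hnz⟩ := hS _ hfin (by
    intro z hz
    obtain ⟨a, b, rfl⟩ := Submodule.mem_span_pair.1 hz
    rw [qf_real_combination hC, qf_real_combination hD, qf_real_combination hE, hDx, hDy, hEx, hEy]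
    intro h1 h2 h3
    have hab : a = 0 ∨ b = 0 := by
      by_contra! hab
      exact hne ⟨by simpa [hab.1, hab.2] using h2, by simpa [hab.1, hab.2] using h3⟩
    rcases hab with rfl | rfl
    · have : b = 0 := by simpa [hCy.ne] using h1
      simp [this]
    · have : a = 0 := by simpa [hCx.ne'] using h1
      simp [this])
  have hform : ∀ a b : ℝ, qf (c • C + d • D + e • E) (a • x + b • y)
      = c * (a ^ 2 * qf C x + 2 * a * b * (⟪C x, y⟫_ℂ).re + b ^ 2 * qf C y)
        + 2 * a * b * (d * (⟪D x, y⟫_ℂ).re + e * (⟪E x, y⟫_ℂ).re) := by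
    intro a b
    rw [qf_add, qf_add, qf_smul, qf_smul, qf_smul, qf_real_combination hC,
      qf_real_combination hD, qf_real_combination hE, hDx, hDy, hEx, hEy]
    ring
  have hnn' : ∀ a b : ℝ, 0 ≤ qf (c • C + d • D + e • E) (a • x + b • y) :=
    fun a b ↦ hnn _ (Submodule.mem_span_pair.2 ⟨a, b, rfl⟩)
  simp only [hform] at hnn'
  have hc : c = 0 := by
    have h1 := hnn' 1 0
    have h2 := hnn' 0 1
    apply le_antisymm <;> nlinarith
  subst hc
  have hde : d * (⟪D x, y⟫_ℂ).re + e * (⟪E x, y⟫_ℂ).re = 0 := by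
    have h1 := hnn' 1 1
    have h2 := hnn' 1 (-1)
    linarith
  refine hnz fun z hz ↦ ?_
  obtain ⟨a, b, rfl⟩ := Submodule.mem_span_pair.1 hz
  rw [hform, hde]
  ring

/-- A binary quadratic form that is nonnegative at the zeros of an indefinite one satisfies the
inequality between diagonal coefficients needed for a Lagrange multiplier. -/
lemma diagonal_nonneg_of_nonneg_on_zeros {p r n α γ β : ℝ} (hp : 0 < p) (hn : 0 < n)
    (h : ∀ a : ℝ, a ^ 2 * p + 2 * a * r - n = 0 → 0 ≤ a ^ 2 * α + 2 * a * γ + β) :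
    0 ≤ α * n + β * p := by
  set s := √(r ^ 2 + p * n) with hs
  have hss : s ^ 2 = r ^ 2 + p * n := Real.sq_sqrt (by positivity)
  have hs0 : 0 < s := Real.sqrt_pos.2 (by positivity)
  have hsr : |r| < s := abs_lt_of_sq_lt_sq (by nlinarith [mul_pos hp hn]) hs0.le
  obtain ⟨h1, h2⟩ := abs_lt.1 hsr
  have key : ∀ t : ℝ, t ^ 2 = r ^ 2 + p * n →
      0 ≤ (t - r) ^ 2 * α + 2 * p * (t - r) * γ + p ^ 2 * β := by
    intro t ht
    have h0 := h ((t - r) / p) (by field_simp; linarith)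
    have h3 := mul_nonneg (sq_nonneg p) h0
    have h4 : p ^ 2 * (((t - r) / p) ^ 2 * α + 2 * ((t - r) / p) * γ + β)
        = (t - r) ^ 2 * α + 2 * p * (t - r) * γ + p ^ 2 * β := by field_simp
    linarith
  have k1 := mul_nonneg (by linarith : 0 ≤ s + r) (key s hss)
  have k2 := mul_nonneg (by linarith : 0 ≤ s - r) (key (-s) (by linarith))
  have k3 : (s + r) * ((s - r) ^ 2 * α + 2 * p * (s - r) * γ + p ^ 2 * β)
      + (s - r) * ((-s - r) ^ 2 * α + 2 * p * (-s - r) * γ + p ^ 2 * β)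
      = (2 * s * p) * (α * n + β * p) := by
    linear_combination (2 * s * α) * hss
  exact nonneg_of_mul_nonneg_right (by linarith : 0 ≤ (2 * s * p) * (α * n + β * p)) (by positivity)

/-- A Lagrange multiplier for a single constraint on a set `N`. -/
lemma exists_multiplier {X : Type*} {N : Set X} {f g : X → ℝ}
    (hpos : ∃ x ∈ N, 0 < g x) (hneg : ∃ x ∈ N, g x < 0)
    (hzero : ∀ x ∈ N, g x = 0 → 0 ≤ f x)
    (hcross : ∀ x ∈ N, ∀ y ∈ N, 0 < g x → g y < 0 → 0 ≤ f x * (-g y) + f y * g x) :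
    ∃ t : ℝ, ∀ x ∈ N, 0 ≤ f x + t * g x := by
  set U : Set ℝ := {t | ∃ x ∈ N, 0 < g x ∧ t = -f x / g x} with hU
  have hub : ∀ y ∈ N, g y < 0 → ∀ t ∈ U, t ≤ f y / (-g y) := by
    rintro y hy hgy _ ⟨x, hx, hgx, rfl⟩
    rw [div_le_div_iff₀ hgx (by linarith)]
    linarith [hcross x hx y hy hgx hgy]
  obtain ⟨x₀, hx₀, hgx₀⟩ := hpos
  obtain ⟨y₀, hy₀, hgy₀⟩ := hneg
  refine ⟨sSup U, fun x hx ↦ ?_⟩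
  rcases lt_trichotomy (g x) 0 with h | h | h
  · have h1 : sSup U ≤ f x / (-g x) := csSup_le ⟨_, x₀, hx₀, hgx₀, rfl⟩ (hub x hx h)
    rw [le_div_iff₀ (by linarith)] at h1
    linarith
  · simpa [h] using hzero x hx h
  · have h1 : -f x / g x ≤ sSup U := le_csSup ⟨_, hub y₀ hy₀ hgy₀⟩ ⟨x, hx, h, rfl⟩
    rw [div_le_iff₀ h] at h1
    linarith

/-- The S-lemma for a weakly indefinite family for which vectors of opposite `B a`-sign, neutral
for the operators indexed by `s`, can be rotated so that all their cross terms vanish. -/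
lemma exists_multipliers {m : ℕ} {B : Fin m → (H →L[ℂ] H)} (hB : ∀ i, IsSelfAdjoint (B i))
    (hw : WeaklyIndefinite B)
    (hrot : ∀ (s : Finset (Fin m)) (a : Fin m), a ∉ s → ∀ x y : H, (∀ i ∈ s, qf (B i) x = 0) →
      (∀ i ∈ s, qf (B i) y = 0) → 0 < qf (B a) x → qf (B a) y < 0 →
      ∃ u : ℂ, ‖u‖ = 1 ∧ ∀ i ∈ s, (⟪B i x, u • y⟫_ℂ).re = 0)
    (s : Finset (Fin m)) : ∀ A : H →L[ℂ] H, IsSelfAdjoint A →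
      (∀ x, (∀ i ∈ s, qf (B i) x = 0) → 0 ≤ qf A x) →
      ∃ l : Fin m → ℝ, ∀ x, 0 ≤ qf A x + ∑ i ∈ s, l i * qf (B i) x := by
  classical
  induction s using Finset.induction_on with
  | empty => exact fun A _ h ↦ ⟨0, fun x ↦ by simpa using h x (by simp)⟩
  | insert a s ha ih =>
    intro A hA h
    have hcomb : ∀ (t : ℝ) (l : Fin m → ℝ) (x : H),
        ∑ i ∈ insert a s, Function.update l a t i * qf (B i) x
          = t * qf (B a) x + ∑ i ∈ s, l i * qf (B i) x := by
      intro t l x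
      rw [Finset.sum_insert ha, Function.update_self]
      congr 1
      refine Finset.sum_congr rfl fun i hi ↦ ?_
      rw [Function.update_of_ne (ne_of_mem_of_not_mem hi ha)]
    have hnot : ∀ (t : ℝ) (l : Fin m → ℝ), t ≠ 0 →
        ¬ ∀ x, 0 ≤ t * qf (B a) x + ∑ i ∈ s, l i * qf (B i) x := by
      intro t l ht hall
      set μ : Fin m → ℝ := fun i ↦ if i ∈ insert a s then Function.update l a t i else 0 with hμ
      obtain ⟨x, hx⟩ := (hw μ fun h0 ↦ ht (by simpa [hμ] using congrFun h0 a)).2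
      rw [qf_sum_smul] at hx
      have h1 := hall x
      rw [← hcomb] at h1
      simp only [hμ, ite_mul, zero_mul, Finset.sum_ite_mem, Finset.univ_inter] at hx
      linarith
    have hpos : ∃ x ∈ {x : H | ∀ i ∈ s, qf (B i) x = 0}, 0 < qf (B a) x := by
      by_contra! hcon
      obtain ⟨l, hl⟩ := ih (-B a) (hB a).neg fun x hx ↦ by
        rw [qf_neg]; linarith [hcon x hx]
      exact hnot (-1) l (by norm_num) fun x ↦ by simpa [qf_neg] using hl x
    have hneg : ∃ x ∈ {x : H | ∀ i ∈ s, qf (B i) x = 0}, qf (B a) x < 0 := by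
      by_contra! hcon
      obtain ⟨l, hl⟩ := ih (B a) (hB a) hcon
      exact hnot 1 l one_ne_zero fun x ↦ by simpa using hl x
    obtain ⟨t, ht⟩ := exists_multiplier (f := qf A) hpos hneg
      (fun x hx h0 ↦ h x (by
        intro i hi
        rcases Finset.mem_insert.1 hi with rfl | hi
        exacts [h0, hx i hi]))
      (by
        intro x hx y hy hxa hya
        obtain ⟨u, hu, hortho⟩ := hrot s a ha x y hx hy hxa hya
        have hyu : ∀ T : H →L[ℂ] H, qf T (u • y) = qf T y :=
          fun T ↦ qf_smul_of_norm_eq_one T y hu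
        refine diagonal_nonneg_of_nonneg_on_zeros (r := (⟪B a x, u • y⟫_ℂ).re)
          (γ := (⟪A x, u • y⟫_ℂ).re) hxa (by linarith) fun b hb ↦ ?_
        have h1 := h (b • x + (1 : ℝ) • (u • y)) (by
          intro i hi
          rw [qf_real_combination (hB i), hyu]
          rcases Finset.mem_insert.1 hi with rfl | hi
          · linarith
          · rw [hx i hi, hy i hi, hortho i hi]; ring)
        rw [qf_real_combination hA, hyu] at h1
        linarith)
    obtain ⟨l, hl⟩ := ih (A + t • B a) (hA.add ((IsSelfAdjoint.all t).smul (hB a)))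
      fun x hx ↦ by rw [qf_add, qf_smul]; exact ht x hx
    refine ⟨Function.update l a t, fun x ↦ ?_⟩
    rw [hcomb]
    have h1 := hl x
    rw [qf_add, qf_smul] at h1
    linarith

/-- Hypotheses (HM) imply strong indefiniteness, and hence the generalized
Krein–Šmul'jan theorem: `A ≥ 0` on `⋂ᵢ Qᵢ` iff `A + ∑ᵢ λᵢBᵢ ≥ 0` is feasible. -/
theorem hestenes_mcshane {m : ℕ} (hm : 3 ≤ m) (B : Fin m → (H →L[ℂ] H))
    (hB : ∀ i, IsSelfAdjoint (B i))
    (hw : WeaklyIndefinite B)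
    (hHM : ∀ S : Submodule ℝ H, Module.finrank ℝ S = 2 →
      ∀ i j k : Fin m, i ≠ j → i ≠ k → j ≠ k →
      (∀ x ∈ S, qf (B i) x = 0 → qf (B j) x = 0 → qf (B k) x = 0 → x = 0) →
      ∃ li lj lk : ℝ, (li, lj, lk) ≠ (0, 0, 0) ∧
        (∀ x ∈ S, 0 ≤ qf (li • B i + lj • B j + lk • B k) x) ∧
        ¬(∀ x ∈ S, qf (li • B i + lj • B j + lk • B k) x = 0)) :
    StronglyIndefinite B ∧
    (∀ A : H →L[ℂ] H, IsSelfAdjoint A →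
      ((∀ x : H, (∀ i, qf (B i) x = 0) → 0 ≤ qf A x) ↔
        ∃ l : Fin m → ℝ, PosSemidef (A + ∑ i, l i • B i))) := by
  have hcross : ∀ i j k : Fin m, i ≠ j → i ≠ k → j ≠ k → ∀ x y : H,
      0 < qf (B i) x → qf (B i) y < 0 → qf (B j) x = 0 → qf (B j) y = 0 →
      qf (B k) x = 0 → qf (B k) y = 0 →
      (⟪B j x, y⟫_ℂ).re = 0 ∧ (⟪B k x, y⟫_ℂ).re = 0 := by
    intro i j k hij hik hjk x y
    refine re_inner_eq_zero_of_opposite_signs (hB i) (hB j) (hB k) fun S hS h ↦ ?_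
    obtain ⟨a, b, c, -, h'⟩ := hHM S hS i j k hij hik hjk h
    exact ⟨a, b, c, h'⟩
  refine ⟨⟨hw, ?_⟩, fun A hA ↦ ⟨fun h ↦ ?_, ?_⟩⟩
  · intro i j k y x hiy hjy hky hix hjx hkx
    have hij : i ≠ j := by rintro rfl; linarith
    have hik : i ≠ k := by rintro rfl; linarith
    rcases eq_or_ne j k with rfl | hjk
    · obtain ⟨θ, hθ, h⟩ := exists_rotation_re_inner_eq_zero (B j x) y
      exact ⟨θ, hθ, h, h⟩
    · exact ⟨0, ⟨le_rfl, Real.pi_pos⟩, by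
        simpa using hcross i j k hij hik hjk x y hix hiy hjx hjy hkx hky⟩
  · obtain ⟨l, hl⟩ := exists_multipliers hB hw (by
      intro s a ha x y hx hy hax hay
      rcases s.eq_empty_or_nonempty with rfl | ⟨j, hj⟩
      · exact ⟨1, by simp, by simp⟩
      by_cases hs : s = {j}
      · subst hs
        obtain ⟨θ, -, h⟩ := exists_rotation_re_inner_eq_zero (B j x) y
        exact ⟨_, Complex.norm_exp_ofReal_mul_I θ, by simpa using h⟩
      · have hnt : s.Nontrivial := (Finset.nontrivial_iff_ne_singleton hj).2 hs
        refine ⟨1, by simp, fun i hi ↦ ?_⟩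
        obtain ⟨k, hk, hki⟩ := hnt.exists_ne i
        simpa using (hcross a i k (ne_of_mem_of_not_mem hi ha).symm
          (ne_of_mem_of_not_mem hk ha).symm hki.symm x y hax hay (hx i hi) (hy i hi)
          (hx k hk) (hy k hk)).1) Finset.univ A hA (by simpa using h)
    exact ⟨l, fun x ↦ by rw [qf_add, qf_sum_smul]; exact hl x⟩
  · rintro ⟨l, hl⟩ x hx
    have h := hl x
    rw [qf_add, qf_sum_smul] at h
    simpa [hx] using h
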